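/- There exists ε > 0 such that E[e^{ε(L_1 + ⋯ + L_k)}] < ∞, where L_i = M + Y_i is the stationary length of queue i; consequently φ(0, ε𝟙) < ∞. -/

import Mathlib

open Filter Topology
open scoped ENNReal

noncomputable section

/-- Traffic intensity ρ = λ / Σ μᵢ. -/
def rho (k : ℕ) (lam : ℝ) (μ : Fin k → ℝ) : ℝ := lam / ∑ i, μ i

/-- Index set of the shortest queues: the zero coordinates of the difference vector. -/
def zeroSet (k : ℕ) (y : Fin k → ℕ) : Finset (Fin k) :=
  Finset.univ.filter (fun i => y i = 0)

/-- One-step transition probability of the uniformized JSQ chain `Z = (M, Y)` on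
`ℕ × (Fin k → ℕ)`, where `M` is the minimum queue length and `Y` the vector of
differences from the minimum. -/
def jsqP (k : ℕ) (lam : ℝ) (μ : Fin k → ℝ) (s s' : ℕ × (Fin k → ℕ)) : ℝ :=
  (if (zeroSet k s.2).card = 1 then
      (if s' = (s.1 + 1, fun j => s.2 j - 1) then lam else 0)
    else
      ∑ i ∈ zeroSet k s.2,
        (if s' = (s.1, Function.update s.2 i 1) then lam / (zeroSet k s.2).card else 0))
  + (∑ j ∈ (zeroSet k s.2)ᶜ,
      (if s' = (s.1, Function.update s.2 j (s.2 j - 1)) then μ j else 0))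
  + (∑ i ∈ zeroSet k s.2,
      (if s' = (if s.1 = 0 then s else (s.1 - 1, fun j => if j = i then 0 else s.2 j + 1))
        then μ i else 0))

/-- The exponential weight `e^{θ·Z}` for `θ ∈ ℝ^{k+1}` and a state `Z = (m, y)`. -/
def expWeight (k : ℕ) (θ : Fin (k + 1) → ℝ) (s : ℕ × (Fin k → ℕ)) : ℝ :=
  Real.exp (θ 0 * (s.1 : ℝ) + ∑ i : Fin k, θ i.succ * (s.2 i : ℝ))

/-- The stationary moment generating function `φ(θ) = E[e^{θ·Z}] ∈ [0,∞]`. -/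
def phi (k : ℕ) (π : ℕ × (Fin k → ℕ) → ℝ) (θ : Fin (k + 1) → ℝ) : ℝ≥0∞ :=
  ∑' s : ℕ × (Fin k → ℕ), ENNReal.ofReal (π s * expWeight k θ s)

/-- `φ_{+U}(θ) = E[e^{θ·Z} 1(Z ∈ S_{+U})]`. -/
def phiPlus (k : ℕ) (π : ℕ × (Fin k → ℕ) → ℝ) (U : Finset (Fin k))
    (θ : Fin (k + 1) → ℝ) : ℝ≥0∞ :=
  ∑' s : ℕ × (Fin k → ℕ),
    if 1 ≤ s.1 ∧ zeroSet k s.2 = U then ENNReal.ofReal (π s * expWeight k θ s) else 0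

/-- `φ_{0U}(θ) = E[e^{θ·Z} 1(Z ∈ S_{0U})]`. -/
def phiZero (k : ℕ) (π : ℕ × (Fin k → ℕ) → ℝ) (U : Finset (Fin k))
    (θ : Fin (k + 1) → ℝ) : ℝ≥0∞ :=
  ∑' s : ℕ × (Fin k → ℕ),
    if s.1 = 0 ∧ zeroSet k s.2 = U then ENNReal.ofReal (π s * expWeight k θ s) else 0

/-- The mgf `γ_{+U}(θ)` of the one-step increment from states in `S_{+U}`. -/
def gammaPlus (k : ℕ) (lam : ℝ) (μ : Fin k → ℝ) (U : Finset (Fin k))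
    (θ : Fin (k + 1) → ℝ) : ℝ :=
  (if U.card = 1 then lam * Real.exp (θ 0 - ∑ j ∈ Uᶜ, θ j.succ)
    else ∑ i ∈ U, (lam / U.card) * Real.exp (θ i.succ))
  + ∑ j ∈ Uᶜ, μ j * Real.exp (-θ j.succ)
  + ∑ i ∈ U, μ i * Real.exp (-θ 0 + ∑ j ∈ Finset.univ.erase i, θ j.succ)

/-- The mgf `γ_{0U}(θ)` of the one-step increment from states in `S_{0U}`. -/
def gammaZero (k : ℕ) (lam : ℝ) (μ : Fin k → ℝ) (U : Finset (Fin k))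
    (θ : Fin (k + 1) → ℝ) : ℝ :=
  (if U.card = 1 then lam * Real.exp (θ 0 - ∑ j ∈ Uᶜ, θ j.succ)
    else ∑ i ∈ U, (lam / U.card) * Real.exp (θ i.succ))
  + ∑ j ∈ Uᶜ, μ j * Real.exp (-θ j.succ)
  + ∑ i ∈ U, μ i

end

/-- Foster–Lyapunov criterion: if a nonnegative function `W` satisfies the geometric drift
inequality `P W ≤ (1 - c) W + C` on the support of a stationary distribution `π`, then `W` has
finite expectation under `π`. -/
theorem summable_mul_of_geometric_drift {S : Type*} (π : S → ℝ) (P : S → S → ℝ) (W D : S → ℝ)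
    (c C : ℝ) (hc : 0 < c) (hC : 0 ≤ C)
    (hπ : ∀ s, 0 ≤ π s) (hπsum : HasSum π 1) (hP : ∀ s s', 0 ≤ P s s')
    (hstat : ∀ s', (∑' s, π s * P s s') = π s') (hW : ∀ s, 0 ≤ W s)
    (hrow : ∀ s, π s ≠ 0 → HasSum (P s) 1)
    (hPW : ∀ s, π s ≠ 0 → HasSum (fun s' => P s s' * W s') (D s))
    (hD : ∀ s, π s ≠ 0 → D s ≤ W s - c * W s + C) :
    Summable (fun s => π s * W s) := by
  classical
  have hle : ∀ F : Finset S, ∑ s ∈ F, π s * W s ≤ C / c := by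
    intro F
    set N : ℝ := ∑ s ∈ F, W s with hN
    have hN0 : 0 ≤ N := Finset.sum_nonneg fun s _ => hW s
    set f : S → ℝ := fun s => min (W s) N with hf
    have hf0 : ∀ s, 0 ≤ f s := fun s => le_min (hW s) hN0
    have hrowf : ∀ s, π s ≠ 0 → Summable (fun s' => P s s' * f s') := fun s hs =>
      Summable.of_nonneg_of_le (fun s' => mul_nonneg (hP s s') (hf0 s'))
        (fun s' => mul_le_mul_of_nonneg_left (min_le_left _ _) (hP s s')) (hPW s hs).summable
    have hrowπ : ∀ s, Summable (fun s' => π s * (P s s' * f s')) := by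
      intro s
      by_cases hs : π s = 0
      · simp [hs]
      · exact (hrowf s hs).mul_left _
    have hPf0 : ∀ s, 0 ≤ ∑' s', P s s' * f s' := fun s =>
      tsum_nonneg fun s' => mul_nonneg (hP s s') (hf0 s')
    have hPfN : ∀ s, π s ≠ 0 → ∑' s', P s s' * f s' ≤ N := by
      intro s hs
      have h1 : HasSum (fun s' => P s s' * N) (1 * N) := (hrow s hs).mul_right N
      have h2 := (hrowf s hs).tsum_le_tsum
        (fun s' => mul_le_mul_of_nonneg_left (min_le_right (W s') N) (hP s s')) h1.summable
      rwa [h1.tsum_eq, one_mul] at h2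
    have hPfD : ∀ s, π s ≠ 0 → ∑' s', P s s' * f s' ≤ D s := by
      intro s hs
      rw [← (hPW s hs).tsum_eq]
      exact (hrowf s hs).tsum_le_tsum
        (fun s' => mul_le_mul_of_nonneg_left (min_le_left (W s') N) (hP s s')) (hPW s hs).summable
    have hsumPf : Summable (fun s => π s * ∑' s', P s s' * f s') := by
      refine Summable.of_nonneg_of_le (fun s => mul_nonneg (hπ s) (hPf0 s)) (fun s => ?_)
        (hπsum.summable.mul_right N)
      by_cases hs : π s = 0
      · simp [hs]
      · exact mul_le_mul_of_nonneg_left (hPfN s hs) (hπ s)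
    have hsumf : Summable (fun s => π s * f s) :=
      Summable.of_nonneg_of_le (fun s => mul_nonneg (hπ s) (hf0 s))
        (fun s => mul_le_mul_of_nonneg_left (min_le_right _ _) (hπ s))
        (hπsum.summable.mul_right N)
    have hprod : Summable (Function.uncurry fun s s' => π s * (P s s' * f s')) := by
      refine (summable_prod_of_nonneg fun x =>
        mul_nonneg (hπ _) (mul_nonneg (hP _ _) (hf0 _))).2 ⟨hrowπ, ?_⟩
      simpa [Function.uncurry, tsum_mul_left] using hsumPf
    have hinv : ∑' s, π s * f s = ∑' s, π s * ∑' s', P s s' * f s' := by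
      have h := hprod.tsum_comm
      simp_rw [tsum_mul_left] at h
      rw [← h]
      refine tsum_congr fun s' => ?_
      rw [← hstat s', ← tsum_mul_right]
      exact tsum_congr fun s => by ring
    have hpt : ∀ s, (if s ∈ F then π s * (c * W s) else 0) - π s * C
        ≤ π s * f s - π s * ∑' s', P s s' * f s' := by
      intro s
      by_cases hs : π s = 0
      · simp [hs]
      have h1 := hPfN s hs
      have h2 := (hPfD s hs).trans (hD s hs)
      have hcW : 0 ≤ c * W s := mul_nonneg hc.le (hW s)
      rw [← mul_sub]
      by_cases hF : s ∈ F
      · have hWN : W s ≤ N := Finset.single_le_sum (fun t _ => hW t) hF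
        have : f s = W s := min_eq_left hWN
        rw [if_pos hF, this, ← mul_sub]
        exact mul_le_mul_of_nonneg_left (by linarith) (hπ s)
      · rw [if_neg hF, zero_sub, ← mul_neg]
        refine mul_le_mul_of_nonneg_left ?_ (hπ s)
        rcases le_total (W s) N with h | h
        · have : f s = W s := min_eq_left h
          rw [this]; linarith
        · have : f s = N := min_eq_right h
          rw [this]; linarith
    have hF : HasSum (fun s => if s ∈ F then π s * (c * W s) else 0)
        (∑ s ∈ F, π s * (c * W s)) := by
      have h := hasSum_sum_of_ne_finset_zero (L := .unconditional S)
        (f := fun s => if s ∈ F then π s * (c * W s) else 0) (s := F) (fun s hs => if_neg hs)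
      rwa [Finset.sum_congr rfl fun s hs => if_pos hs] at h
    have hfin := hasSum_le hpt (hF.sub (hπsum.mul_right C)) (hsumf.hasSum.sub hsumPf.hasSum)
    rw [hinv, sub_self, one_mul, sub_nonpos] at hfin
    rw [le_div_iff₀ hc, Finset.sum_mul]
    refine le_trans (le_of_eq (Finset.sum_congr rfl fun s _ => by ring)) hfin
  exact summable_of_sum_le (fun s => mul_nonneg (hπ s) (hW s)) hle

/-- The one-step expectation `E[f(Z₁) | Z₀ = s]`. -/
noncomputable def jsqStep (k : ℕ) (lam : ℝ) (μ : Fin k → ℝ) (f : ℕ × (Fin k → ℕ) → ℝ)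
    (s : ℕ × (Fin k → ℕ)) : ℝ :=
  (if (zeroSet k s.2).card = 1 then lam * f (s.1 + 1, fun j => s.2 j - 1)
    else ∑ i ∈ zeroSet k s.2, lam / (zeroSet k s.2).card * f (s.1, Function.update s.2 i 1))
  + (∑ j ∈ (zeroSet k s.2)ᶜ, μ j * f (s.1, Function.update s.2 j (s.2 j - 1)))
  + (∑ i ∈ zeroSet k s.2,
      μ i * f (if s.1 = 0 then s else (s.1 - 1, fun j => if j = i then 0 else s.2 j + 1)))

theorem hasSum_ite_eq_mul {S : Type*} [DecidableEq S] (f : S → ℝ) (t : S) (a : ℝ) :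
    HasSum (fun s' => (if s' = t then a else 0) * f s') (a * f t) := by
  convert hasSum_ite_eq t (a * f t) using 2 with s'
  split_ifs with h
  · rw [h]
  · rw [zero_mul]

theorem hasSum_jsqP_mul (k : ℕ) (lam : ℝ) (μ : Fin k → ℝ) (f : ℕ × (Fin k → ℕ) → ℝ)
    (s : ℕ × (Fin k → ℕ)) :
    HasSum (fun s' => jsqP k lam μ s s' * f s') (jsqStep k lam μ f s) := by
  unfold jsqP jsqStep
  simp_rw [add_mul, Finset.sum_mul]
  refine HasSum.add (HasSum.add ?_ ?_) ?_
  · split_ifs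
    · exact hasSum_ite_eq_mul f _ _
    · simp_rw [Finset.sum_mul]
      exact hasSum_sum fun i _ => hasSum_ite_eq_mul f _ _
  · exact hasSum_sum fun i _ => hasSum_ite_eq_mul f _ _
  · exact hasSum_sum fun i _ => hasSum_ite_eq_mul f _ _

theorem jsqP_nonneg (k : ℕ) (lam : ℝ) (μ : Fin k → ℝ) (hlam : 0 ≤ lam) (hμ : ∀ i, 0 ≤ μ i)
    (s s' : ℕ × (Fin k → ℕ)) : 0 ≤ jsqP k lam μ s s' := by
  unfold jsqP
  refine add_nonneg (add_nonneg ?_ ?_) ?_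
  · split_ifs
    · exact hlam
    · exact le_rfl
    · exact Finset.sum_nonneg fun i _ => by split_ifs <;> positivity
  · exact Finset.sum_nonneg fun i _ => by split_ifs <;> simp [hμ]
  · exact Finset.sum_nonneg fun i _ => by split_ifs <;> simp [hμ]

/-- If every arrival transition changes `f` to at most `A` and every service completion at queue
`i` changes it to at most `B i`, then `E[f(Z₁) | Z₀ = s] ≤ λ A + ∑ μᵢ Bᵢ`. -/
theorem jsqStep_le (k : ℕ) (lam : ℝ) (μ : Fin k → ℝ) (hlam : 0 ≤ lam) (hμ : ∀ i, 0 ≤ μ i)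
    (f : ℕ × (Fin k → ℕ) → ℝ) (s : ℕ × (Fin k → ℕ)) (hs : (zeroSet k s.2).Nonempty)
    (A : ℝ) (B : Fin k → ℝ)
    (hA₁ : (zeroSet k s.2).card = 1 → f (s.1 + 1, fun j => s.2 j - 1) ≤ A)
    (hA₂ : ∀ i ∈ zeroSet k s.2, f (s.1, Function.update s.2 i 1) ≤ A)
    (hB₁ : ∀ j ∉ zeroSet k s.2, f (s.1, Function.update s.2 j (s.2 j - 1)) ≤ B j)
    (hB₂ : ∀ i ∈ zeroSet k s.2,
      f (if s.1 = 0 then s else (s.1 - 1, fun j => if j = i then 0 else s.2 j + 1)) ≤ B i) :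
    jsqStep k lam μ f s ≤ lam * A + ∑ i, μ i * B i := by
  unfold jsqStep
  rw [← Finset.sum_compl_add_sum (zeroSet k s.2) (fun i => μ i * B i), ← add_assoc]
  refine add_le_add (add_le_add ?_ ?_) ?_
  · split_ifs with h
    · exact mul_le_mul_of_nonneg_left (hA₁ h) hlam
    · calc _ ≤ ∑ i ∈ zeroSet k s.2, lam / (zeroSet k s.2).card * A :=
            Finset.sum_le_sum fun i hi => mul_le_mul_of_nonneg_left (hA₂ i hi) (by positivity)
        _ = lam * A := by
            have : ((zeroSet k s.2).card : ℝ) ≠ 0 := by exact_mod_cast hs.card_pos.ne'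
            rw [Finset.sum_const, nsmul_eq_mul]
            field_simp
  · exact Finset.sum_le_sum fun i hi =>
      mul_le_mul_of_nonneg_left (hB₁ i (Finset.mem_compl.1 hi)) (hμ i)
  · exact Finset.sum_le_sum fun i hi => mul_le_mul_of_nonneg_left (hB₂ i hi) (hμ i)

theorem jsqStep_one (k : ℕ) (lam : ℝ) (μ : Fin k → ℝ) (s : ℕ × (Fin k → ℕ))
    (hs : (zeroSet k s.2).Nonempty) :
    jsqStep k lam μ (fun _ => 1) s = lam + ∑ i, μ i := by
  have hc : ((zeroSet k s.2).card : ℝ) ≠ 0 := by exact_mod_cast hs.card_pos.ne'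
  unfold jsqStep
  rw [← Finset.sum_compl_add_sum (zeroSet k s.2) μ, ← add_assoc]
  congr 1
  · congr 1
    · split_ifs
      · simp
      · rw [Finset.sum_const, nsmul_eq_mul]
        field_simp
    · simp
  · simp

/-- The Lyapunov function `∑ᵢ e^{ε Lᵢ}` in the queue lengths `Lᵢ = M + Yᵢ`. -/
noncomputable def sumExp (k : ℕ) (ε : ℝ) (s : ℕ × (Fin k → ℕ)) : ℝ :=
  ∑ i, Real.exp (ε * ((s.1 : ℝ) + (s.2 i : ℝ)))

theorem sumExp_nonneg (k : ℕ) (ε : ℝ) (s : ℕ × (Fin k → ℕ)) : 0 ≤ sumExp k ε s :=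
  Finset.sum_nonneg fun _ _ => (Real.exp_pos _).le

/-- Changing the length of a single queue changes only one summand of `sumExp`. -/
theorem sumExp_eq_of_agree (k : ℕ) (ε : ℝ) (s t : ℕ × (Fin k → ℕ)) (i : Fin k)
    (h : ∀ j, j ≠ i → t.1 + t.2 j = s.1 + s.2 j) :
    sumExp k ε t = sumExp k ε s - Real.exp (ε * ((s.1 : ℝ) + (s.2 i : ℝ)))
      + Real.exp (ε * ((t.1 : ℝ) + (t.2 i : ℝ))) := by
  unfold sumExp
  rw [← Finset.add_sum_erase _ _ (Finset.mem_univ i),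
    ← Finset.add_sum_erase (f := fun i => Real.exp (ε * ((s.1 : ℝ) + (s.2 i : ℝ)))) _
      (Finset.mem_univ i)]
  have : ∑ j ∈ Finset.univ.erase i, Real.exp (ε * ((t.1 : ℝ) + (t.2 j : ℝ)))
      = ∑ j ∈ Finset.univ.erase i, Real.exp (ε * ((s.1 : ℝ) + (s.2 j : ℝ))) := by
    refine Finset.sum_congr rfl fun j hj => ?_
    have := h j (Finset.ne_of_mem_erase hj)
    rw [← Nat.cast_add, ← Nat.cast_add, this]
  rw [this]
  ring

theorem mem_zeroSet {k : ℕ} {y : Fin k → ℕ} {i : Fin k} : i ∈ zeroSet k y ↔ y i = 0 := by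
  simp [zeroSet]

theorem sumExp_arrival (k : ℕ) (ε : ℝ) (s t : ℕ × (Fin k → ℕ)) (i : Fin k) (hi : s.2 i = 0)
    (h : ∀ j, j ≠ i → t.1 + t.2 j = s.1 + s.2 j) (hti : t.1 + t.2 i = s.1 + 1) :
    sumExp k ε t = sumExp k ε s + Real.exp (ε * s.1) * (Real.exp ε - 1) := by
  rw [sumExp_eq_of_agree k ε s t i h, ← Nat.cast_add t.1, hti, hi]
  push_cast
  rw [mul_add ε _ 1, Real.exp_add, mul_one, add_zero]
  ring

theorem sumExp_service (k : ℕ) (ε : ℝ) (s t : ℕ × (Fin k → ℕ)) (i : Fin k)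
    (h : ∀ j, j ≠ i → t.1 + t.2 j = s.1 + s.2 j) (hti : t.1 + t.2 i + 1 = s.1 + s.2 i) :
    sumExp k ε t = sumExp k ε s
      - (1 - Real.exp (-ε)) * Real.exp (ε * ((s.1 : ℝ) + (s.2 i : ℝ))) := by
  have hr : ((s.1 : ℝ) + (s.2 i : ℝ)) = ((t.1 : ℝ) + (t.2 i : ℝ)) + 1 := by exact_mod_cast hti.symm
  have he : Real.exp (ε * ((t.1 : ℝ) + (t.2 i : ℝ)))
      = Real.exp (-ε) * Real.exp (ε * ((s.1 : ℝ) + (s.2 i : ℝ))) := by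
    rw [← Real.exp_add, hr]
    ring_nf
  rw [sumExp_eq_of_agree k ε s t i h, he]
  ring

theorem jsqStep_sumExp_le (k : ℕ) (lam : ℝ) (μ : Fin k → ℝ) (hlam : 0 ≤ lam)
    (hμ : ∀ i, 0 ≤ μ i) (ε : ℝ) (hε : 0 ≤ ε) (s : ℕ × (Fin k → ℕ))
    (hs : (zeroSet k s.2).Nonempty) :
    jsqStep k lam μ (sumExp k ε) s ≤
      lam * (sumExp k ε s + Real.exp (ε * s.1) * (Real.exp ε - 1)) +
      ∑ i, μ i * (sumExp k ε s
        - (1 - Real.exp (-ε)) * Real.exp (ε * ((s.1 : ℝ) + (s.2 i : ℝ)))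
        + (1 - Real.exp (-ε))) := by
  have hδ : 0 ≤ 1 - Real.exp (-ε) := by
    have : Real.exp (-ε) ≤ 1 := Real.exp_le_one_iff.2 (by linarith)
    linarith
  refine jsqStep_le k lam μ hlam hμ _ s hs _ _ (fun hcard => ?_) (fun i hi => ?_)
    (fun j hj => ?_) (fun i hi => ?_)
  · obtain ⟨i, hU⟩ := Finset.card_eq_one.1 hcard
    have hi : s.2 i = 0 := mem_zeroSet.1 (hU ▸ Finset.mem_singleton_self i)
    refine (sumExp_arrival k ε s _ i hi (fun j hj => ?_) ?_).le
    · have : s.2 j ≠ 0 := fun h0 => hj (Finset.mem_singleton.1 (hU ▸ mem_zeroSet.2 h0))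
      dsimp only
      omega
    · simp [hi]
  · refine (sumExp_arrival k ε s _ i (mem_zeroSet.1 hi) (fun j hj => ?_) ?_).le
    · simp [hj]
    · simp
  · have h0 : s.2 j ≠ 0 := fun h => hj (mem_zeroSet.2 h)
    rw [sumExp_service k ε s _ j (fun l hl => by simp [hl]) (by simp; omega)]
    linarith
  · have h0 : s.2 i = 0 := mem_zeroSet.1 hi
    split_ifs with hm
    · simp [hm, h0]
    · rw [sumExp_service k ε s _ i (fun l hl => by simp [hl]; omega) (by simp [h0]; omega)]
      linarith

/-- Geometric drift of `sumExp` for the join-the-shortest-queue chain. -/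
theorem jsqStep_sumExp_drift (k : ℕ) (lam : ℝ) (μ : Fin k → ℝ) (hlam : 0 < lam)
    (hμ : ∀ i, 0 < μ i) (hnorm : lam + ∑ i, μ i = 1) (ε : ℝ) (hε : 0 < ε)
    (hρ : rho k lam μ * Real.exp ε < 1) (ν : ℝ) (hν : ∀ i, ν ≤ μ i) (s : ℕ × (Fin k → ℕ))
    (hs : (zeroSet k s.2).Nonempty) :
    jsqStep k lam μ (sumExp k ε) s ≤ sumExp k ε s
      - (1 - Real.exp (-ε)) * (1 - rho k lam μ * Real.exp ε) * ν * sumExp k ε s + 1 := by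
  set a : Fin k → ℝ := fun i => Real.exp (ε * ((s.1 : ℝ) + (s.2 i : ℝ))) with ha
  set G : ℝ := ∑ i, μ i * a i with hG
  set δ : ℝ := 1 - Real.exp (-ε) with hδdef
  have hδ : 0 < δ := by
    have : Real.exp (-ε) < 1 := Real.exp_lt_one_iff.2 (by linarith)
    linarith
  have hδ1 : δ ≤ 1 := by linarith [Real.exp_pos (-ε)]
  have hμpos : 0 < ∑ i, μ i :=
    Finset.sum_pos (fun i _ => hμ i) ⟨hs.choose, Finset.mem_univ _⟩
  have hstep := jsqStep_sumExp_le k lam μ hlam.le (fun i => (hμ i).le) ε hε.le s hs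
  have hsplit : ∑ i, μ i * (sumExp k ε s - δ * a i + δ)
      = (∑ i, μ i) * (sumExp k ε s + δ) - δ * G := by
    rw [hG, Finset.sum_mul, Finset.mul_sum, ← Finset.sum_sub_distrib]
    exact Finset.sum_congr rfl fun i _ => by ring
  have hmin : lam * Real.exp (ε * s.1) ≤ rho k lam μ * G := by
    have h1 : (∑ i, μ i) * Real.exp (ε * s.1) ≤ G := by
      rw [Finset.sum_mul]
      refine Finset.sum_le_sum fun i _ => mul_le_mul_of_nonneg_left ?_ (hμ i).le
      refine Real.exp_le_exp.2 (mul_le_mul_of_nonneg_left ?_ hε.le)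
      linarith [(Nat.cast_nonneg (s.2 i) : (0 : ℝ) ≤ s.2 i)]
    unfold rho
    calc lam * Real.exp (ε * s.1)
        = lam / (∑ i, μ i) * ((∑ i, μ i) * Real.exp (ε * s.1)) := by field_simp
      _ ≤ _ := mul_le_mul_of_nonneg_left h1 (by positivity)
  have hexp : Real.exp ε - 1 = Real.exp ε * δ := by
    rw [hδdef, mul_sub, ← Real.exp_add]
    simp
  have hGν : ν * sumExp k ε s ≤ G := by
    unfold sumExp
    rw [Finset.mul_sum]
    exact Finset.sum_le_sum fun i _ =>
      mul_le_mul_of_nonneg_right (hν i) (Real.exp_pos _).le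
  have h1 : lam * Real.exp (ε * s.1) * (Real.exp ε * δ)
      ≤ rho k lam μ * G * (Real.exp ε * δ) :=
    mul_le_mul_of_nonneg_right hmin (by positivity)
  have h2 : δ * (1 - rho k lam μ * Real.exp ε) * (ν * sumExp k ε s)
      ≤ δ * (1 - rho k lam μ * Real.exp ε) * G :=
    mul_le_mul_of_nonneg_left hGν (mul_nonneg hδ.le (by linarith))
  have h3 : (∑ i, μ i) * δ ≤ 1 := by
    have : ∑ i, μ i ≤ 1 := by linarith
    nlinarith
  have hsum : ∑ i, μ i = 1 - lam := by linarith
  rw [hsplit, hexp] at hstep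
  rw [hsum] at hstep h3
  linarith

theorem exp_div_mul_sum_le_sumExp (k : ℕ) (hk : 0 < k) (ε : ℝ) (hε : 0 ≤ ε)
    (s : ℕ × (Fin k → ℕ)) :
    Real.exp (ε / k * ∑ i, ((s.1 : ℝ) + (s.2 i : ℝ))) ≤ sumExp k ε s := by
  have hne : (Finset.univ : Finset (Fin k)).Nonempty := ⟨⟨0, hk⟩, Finset.mem_univ _⟩
  obtain ⟨i, -, hi⟩ := Finset.exists_max_image Finset.univ s.2 hne
  have hk' : (0 : ℝ) < k := by exact_mod_cast hk
  have hsum : ∑ j, ((s.1 : ℝ) + (s.2 j : ℝ)) ≤ k * ((s.1 : ℝ) + (s.2 i : ℝ)) := by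
    calc _ ≤ ∑ _j : Fin k, ((s.1 : ℝ) + (s.2 i : ℝ)) :=
          Finset.sum_le_sum fun j hj => by
            have : (s.2 j : ℝ) ≤ s.2 i := by exact_mod_cast hi j hj
            linarith
      _ = _ := by simp [mul_add]
  calc Real.exp (ε / k * ∑ i, ((s.1 : ℝ) + (s.2 i : ℝ)))
      ≤ Real.exp (ε * ((s.1 : ℝ) + (s.2 i : ℝ))) := by
        refine Real.exp_le_exp.2 ?_
        calc _ ≤ ε / k * (k * ((s.1 : ℝ) + (s.2 i : ℝ))) :=
              mul_le_mul_of_nonneg_left hsum (by positivity)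
          _ = _ := by field_simp
    _ ≤ sumExp k ε s :=
        Finset.single_le_sum (f := fun i => Real.exp (ε * ((s.1 : ℝ) + (s.2 i : ℝ))))
          (fun _ _ => (Real.exp_pos _).le) (Finset.mem_univ i)

/-- **Light-tail property (exponential tightness) of the stationary distribution:**
there exists `ε > 0` with `E[e^{ε (L₁+⋯+L_k)}] < ∞`, where `L_i = M + Y_i`;
consequently `φ(0, ε·𝟙) < ∞`. -/
theorem jsq_exponential_tightness
    (k : ℕ) (hk : 2 ≤ k) (lam : ℝ) (μ : Fin k → ℝ)
    (hlam : 0 < lam) (hμ : ∀ i, 0 < μ i)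
    (hnorm : lam + ∑ i, μ i = 1)
    (hρ : rho k lam μ < 1)
    (π : ℕ × (Fin k → ℕ) → ℝ)
    (hπnn : ∀ s, 0 ≤ π s)
    (hπsupp : ∀ s, π s ≠ 0 → ∃ i : Fin k, s.2 i = 0)
    (hπsum : HasSum π 1)
    (hπstat : ∀ s', (∑' s, π s * jsqP k lam μ s s') = π s') :
    ∃ ε : ℝ, 0 < ε ∧
      (∑' s : ℕ × (Fin k → ℕ),
          ENNReal.ofReal (π s * Real.exp (ε * ∑ i : Fin k, ((s.1 : ℝ) + (s.2 i : ℝ))))) < ⊤ ∧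
      phi k π (Fin.cons 0 (fun _ => ε)) < ⊤ := by
  have hk0 : 0 < k := by omega
  have hne : (Finset.univ : Finset (Fin k)).Nonempty := ⟨⟨0, hk0⟩, Finset.mem_univ _⟩
  have hρ0 : 0 < rho k lam μ := div_pos hlam (Finset.sum_pos (fun i _ => hμ i) hne)
  obtain ⟨ε, hε, hρε⟩ : ∃ ε : ℝ, 0 < ε ∧ rho k lam μ * Real.exp ε < 1 := by
    have hlog : Real.log (rho k lam μ) < 0 := Real.log_neg hρ0 hρ
    refine ⟨-Real.log (rho k lam μ) / 2, by linarith, ?_⟩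
    nth_rewrite 1 [← Real.exp_log hρ0]
    rw [← Real.exp_add]
    exact Real.exp_lt_one_iff.2 (by linarith)
  obtain ⟨i₀, -, hi₀⟩ := Finset.exists_min_image Finset.univ μ hne
  have hzs : ∀ s, π s ≠ 0 → (zeroSet k s.2).Nonempty := fun s hs =>
    (hπsupp s hs).imp fun i hi => mem_zeroSet.2 hi
  have hδ : 0 < 1 - Real.exp (-ε) := sub_pos.2 (Real.exp_lt_one_iff.2 (by linarith))
  have hsummable : Summable (fun s => π s * sumExp k ε s) :=
    summable_mul_of_geometric_drift π (jsqP k lam μ) (sumExp k ε)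
      (jsqStep k lam μ (sumExp k ε))
      ((1 - Real.exp (-ε)) * (1 - rho k lam μ * Real.exp ε) * μ i₀) 1
      (mul_pos (mul_pos hδ (sub_pos.2 hρε)) (hμ i₀)) zero_le_one hπnn hπsum
      (jsqP_nonneg k lam μ hlam.le fun i => (hμ i).le) hπstat (sumExp_nonneg k ε)
      (fun s hs => by
        have h := hasSum_jsqP_mul k lam μ (fun _ => 1) s
        rw [jsqStep_one k lam μ s (hzs s hs), hnorm] at h
        simpa using h)
      (fun s _ => hasSum_jsqP_mul k lam μ (sumExp k ε) s)
      (fun s hs => jsqStep_sumExp_drift k lam μ hlam hμ hnorm ε hε hρε (μ i₀)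
        (fun i => hi₀ i (Finset.mem_univ i)) s (hzs s hs))
  have hε' : 0 < ε / k := div_pos hε (by exact_mod_cast hk0)
  have hmain : (∑' s : ℕ × (Fin k → ℕ), ENNReal.ofReal
      (π s * Real.exp (ε / k * ∑ i : Fin k, ((s.1 : ℝ) + (s.2 i : ℝ))))) < ⊤ :=
    lt_of_le_of_lt (ENNReal.tsum_le_tsum fun s => ENNReal.ofReal_le_ofReal
      (mul_le_mul_of_nonneg_left (exp_div_mul_sum_le_sumExp k hk0 ε hε.le s) (hπnn s)))
      hsummable.tsum_ofReal_lt_top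
  refine ⟨ε / k, hε', hmain, lt_of_le_of_lt (ENNReal.tsum_le_tsum fun s =>
    ENNReal.ofReal_le_ofReal (mul_le_mul_of_nonneg_left ?_ (hπnn s))) hmain⟩
  refine Real.exp_le_exp.2 ?_
  simp only [Fin.cons_zero, Fin.cons_succ, zero_mul, zero_add, ← Finset.mul_sum]
  exact mul_le_mul_of_nonneg_left (Finset.sum_le_sum fun i _ =>
    le_add_of_nonneg_left (Nat.cast_nonneg _)) hε'.le
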